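/- arXiv:1911.05982 — 2 statements merged into one kernel-verified Lean document; each statement's English description precedes it below -/
import Mathlib

section
/- If (x₁,…,xₙ) ∈ ℝⁿ is a critical point of the continuous Hahn Morse function V, i.e. g_a(x_j) + g_b(x_j) + Σ_{k≠j} arctan(x_j − x_k) = (π/2)(2j − n − 1) for every j = 1,…,n, then the coordinates are strictly increasing: x₁ < x₂ < ⋯ < xₙ. -/
/-- `g_a(θ) = (1/2)(arctan((θ+Im a)/Re a) + arctan((θ−Im a)/Re a))`. -/
noncomputable def gfun (a : ℂ) (θ : ℝ) : ℝ :=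
  (Real.arctan ((θ + a.im) / a.re) + Real.arctan ((θ - a.im) / a.re)) / 2

/-- `G_a(s) = ∫₀ˢ g_a(θ) dθ`. -/
noncomputable def Gfun (a : ℂ) (s : ℝ) : ℝ := ∫ θ in (0:ℝ)..s, gfun a θ

/-- `F(s) = ∫₀ˢ arctan(θ) dθ`. -/
noncomputable def Ffun (s : ℝ) : ℝ := ∫ θ in (0:ℝ)..s, Real.arctan θ

/-- The continuous Hahn Morse function
`V(x) = Σ_{j<k} F(x_j − x_k) + Σ_j (G_a(x_j) + G_b(x_j) + (π/2)(n+1−2j)x_j)`,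
with `j, k` running through `1, …, n` (so a Lean index `j : Fin n` corresponds to `j+1`). -/
noncomputable def V (n : ℕ) (a b : ℂ) (x : Fin n → ℝ) : ℝ :=
  (∑ j : Fin n, ∑ k : Fin n, if j < k then Ffun (x j - x k) else 0)
  + ∑ j : Fin n, (Gfun a (x j) + Gfun b (x j)
      + (Real.pi / 2) * ((n : ℝ) + 1 - 2 * (((j : ℕ) : ℝ) + 1)) * x j)

/-- Either `a` and `b` are both real, or `b = conj a`. -/
def PairCond (a b : ℂ) : Prop := (a.im = 0 ∧ b.im = 0) ∨ b = (starRingEnd ℂ) a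

theorem gfun_strictMono {a : ℂ} (ha : 0 < a.re) : StrictMono (gfun a) := by
  intro s t hst
  have h₁ : Real.arctan ((s + a.im) / a.re) < Real.arctan ((t + a.im) / a.re) :=
    Real.arctan_strictMono (by gcongr)
  have h₂ : Real.arctan ((s - a.im) / a.re) < Real.arctan ((t - a.im) / a.re) :=
    Real.arctan_strictMono (by gcongr)
  unfold gfun
  linarith

/-- at a critical point of the continuous Hahn Morse function `V`, i.e. a
solution of `g_a(x_j) + g_b(x_j) + Σ_{k≠j} arctan(x_j − x_k) = (π/2)(2j − n − 1)` for
`j = 1, …, n`, the coordinates are strictly increasing. -/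
theorem continuousHahn_critical_point_strictMono
    (n : ℕ) (hn : 1 ≤ n) (a b : ℂ) (ha : 0 < a.re) (hb : 0 < b.re) (hab : PairCond a b)
    (x : Fin n → ℝ)
    (hcrit : ∀ j : Fin n,
      gfun a (x j) + gfun b (x j)
        + ∑ k ∈ Finset.univ.erase j, Real.arctan (x j - x k)
      = (Real.pi / 2) * (2 * (((j : ℕ) : ℝ) + 1) - (n : ℝ) - 1)) :
    StrictMono x := by
  have hmono : Monotone fun t : ℝ =>
      gfun a t + gfun b t + ∑ k : Fin n, Real.arctan (t - x k) := fun s t hst =>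
    add_le_add
      (add_le_add ((gfun_strictMono ha).monotone hst) ((gfun_strictMono hb).monotone hst))
      (Finset.sum_le_sum fun k _ => Real.arctan_strictMono.monotone (by linarith))
  have hval : ∀ j : Fin n, gfun a (x j) + gfun b (x j) + ∑ k : Fin n, Real.arctan (x j - x k)
      = (Real.pi / 2) * (2 * (((j : ℕ) : ℝ) + 1) - (n : ℝ) - 1) := fun j => by
    rw [← hcrit j, Finset.sum_erase _ (by simp)]
  intro i j hij
  refine hmono.reflect_lt ?_
  have hij' : ((i : ℕ) : ℝ) < ((j : ℕ) : ℝ) := by exact_mod_cast hij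
  simp only [hval]
  exact mul_lt_mul_of_pos_left (by linarith) Real.pi_div_two_pos
end

section
/- Let (x₁*, …, xₙ*) with x₁* < ⋯ < xₙ* be the unique global minimizer of the continuous Hahn Morse function V and set Rₙ = xₙ*. Let x : [0,∞) → ℝⁿ be a differentiable solution of the gradient system dx_j/dt = −∂V/∂x_j (j = 1,…,n) with arbitrary initial condition x(0) ∈ ℝⁿ, and fix any κ with 0 < κ < Re(a)/(Re(a)² + (Rₙ + |Im(a)|)²) + Re(b)/(Re(b)² + (Rₙ + |Im(b)|)²). Then there exists a constant K > 0 such that |x_j(t) − x_j*| ≤ K·e^{−κt} for all j = 1,…,n and all t ≥ 0. -/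
/-- The `j`-th partial derivative of the Morse function `V`. -/
noncomputable def gradV (n : ℕ) (a b : ℂ) (x : Fin n → ℝ) (j : Fin n) : ℝ :=
  (Real.pi / 2) * ((n : ℝ) + 1 - 2 * (((j : ℕ) : ℝ) + 1)) + gfun a (x j) + gfun b (x j)
    + ∑ k ∈ Finset.univ.erase j, Real.arctan (x j - x k)

/-- A lower bound for the derivative of `gfun a` on `[-M, M]`. -/
noncomputable def slopeBound (a : ℂ) (M : ℝ) : ℝ := a.re / (a.re ^ 2 + (M + |a.im|) ^ 2)

lemma sum_mul_sum_erase_of_antisymm {n : ℕ} (A : Fin n → Fin n → ℝ)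
    (hA : ∀ p q, A q p = -A p q) (u : Fin n → ℝ) :
    ∑ p, u p * ∑ q ∈ Finset.univ.erase p, A p q
      = ∑ p, ∑ q, if p < q then A p q * (u p - u q) else 0 := by
  have h1 : ∀ p, u p * ∑ q ∈ Finset.univ.erase p, A p q
      = (∑ q, if p < q then A p q * u p else 0) + ∑ q, if q < p then A p q * u p else 0 := by
    intro p
    have hp : A p p = 0 := by linarith [hA p p]
    rw [Finset.sum_erase _ hp, Finset.mul_sum, ← Finset.sum_add_distrib]
    refine Finset.sum_congr rfl fun q _ => ?_
    rcases lt_trichotomy p q with h | h | h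
    · simp [h, h.not_gt, mul_comm]
    · subst h; simp [hp]
    · simp [h, h.not_gt, mul_comm]
  rw [Finset.sum_congr rfl fun p _ => h1 p, Finset.sum_add_distrib]
  rw [Finset.sum_comm (f := fun p q => if q < p then A p q * u p else 0),
    ← Finset.sum_add_distrib]
  refine Finset.sum_congr rfl fun p _ => ?_
  rw [← Finset.sum_add_distrib]
  refine Finset.sum_congr rfl fun q _ => ?_
  split_ifs
  · rw [hA p q]; ring
  · simp

lemma hasDerivAt_gfun (a : ℂ) (θ : ℝ) :
    HasDerivAt (gfun a)
      ((1 / (1 + ((θ + a.im) / a.re) ^ 2) * (1 / a.re)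
        + 1 / (1 + ((θ - a.im) / a.re) ^ 2) * (1 / a.re)) / 2) θ := by
  have h1 := (((hasDerivAt_id θ).add_const a.im).div_const a.re).arctan
  have h2 := (((hasDerivAt_id θ).sub_const a.im).div_const a.re).arctan
  exact (h1.add h2).div_const 2

lemma continuous_gfun (a : ℂ) : Continuous (gfun a) :=
  continuous_iff_continuousAt.2 fun θ => (hasDerivAt_gfun a θ).continuousAt

lemma gfun_neg (a : ℂ) (θ : ℝ) : gfun a (-θ) = -gfun a θ := by
  have h1 : (-θ + a.im) / a.re = -((θ - a.im) / a.re) := by ring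
  have h2 : (-θ - a.im) / a.re = -((θ + a.im) / a.re) := by ring
  simp only [gfun, h1, h2, Real.arctan_neg]
  ring

lemma slopeBound_pos {a : ℂ} (ha : 0 < a.re) (M : ℝ) : 0 < slopeBound a M := by
  unfold slopeBound; positivity

lemma continuous_slopeBound {a : ℂ} (ha : 0 < a.re) : Continuous (slopeBound a) := by
  unfold slopeBound
  refine Continuous.div (by fun_prop) (by fun_prop) fun M => ?_
  positivity

lemma slopeBound_le_deriv_gfun {a : ℂ} (ha : 0 < a.re) {M θ : ℝ} (hθ : |θ| ≤ M) :
    slopeBound a M ≤ deriv (gfun a) θ := by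
  rw [(hasDerivAt_gfun a θ).deriv]
  have key : ∀ z : ℝ, |z| ≤ M + |a.im| →
      slopeBound a M ≤ 1 / (1 + (z / a.re) ^ 2) * (1 / a.re) := by
    intro z hz
    have e : 1 / (1 + (z / a.re) ^ 2) * (1 / a.re) = a.re / (a.re ^ 2 + z ^ 2) := by
      field_simp
    have hsq : z ^ 2 ≤ (M + |a.im|) ^ 2 := by
      rw [← sq_abs z]; gcongr
    rw [e, slopeBound]
    gcongr
  have h1 := key (θ + a.im) ((abs_add_le _ _).trans (by gcongr))
  have h2 := key (θ - a.im) ((abs_sub _ _).trans (by gcongr))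
  linarith

lemma slopeBound_mul_sq_le {a : ℂ} (ha : 0 < a.re) {M x y : ℝ} (hx : |x| ≤ M) (hy : |y| ≤ M) :
    slopeBound a M * (x - y) ^ 2 ≤ (x - y) * (gfun a x - gfun a y) := by
  have hle : ∀ {u v : ℝ}, |u| ≤ M → |v| ≤ M → u ≤ v →
      slopeBound a M * (v - u) ≤ gfun a v - gfun a u := by
    intro u v hu hv huv
    refine (convex_Icc (-M) M).mul_sub_le_image_sub_of_le_deriv
      (continuous_gfun a).continuousOn
      (fun θ _ => (hasDerivAt_gfun a θ).differentiableAt.differentiableWithinAt)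
      (fun θ hθ => slopeBound_le_deriv_gfun ha (abs_le.2 (Set.mem_Icc.1 (interior_subset hθ))))
      u (abs_le.1 hu) v (abs_le.1 hv) huv
  rcases le_total x y with h | h
  · nlinarith [hle hx hy h]
  · nlinarith [hle hy hx h]

lemma slopeBound_mul_sum_sq_le {n : ℕ} {a b : ℂ} (ha : 0 < a.re) (hb : 0 < b.re) {M : ℝ}
    {x y : Fin n → ℝ} (hx : ∀ j, |x j| ≤ M) (hy : ∀ j, |y j| ≤ M) :
    (slopeBound a M + slopeBound b M) * ∑ j, (x j - y j) ^ 2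
      ≤ ∑ j, (x j - y j) * (gradV n a b x j - gradV n a b y j) := by
  have hpair := sum_mul_sum_erase_of_antisymm
    (fun p q => Real.arctan (x p - x q) - Real.arctan (y p - y q))
    (fun p q => by
      rw [← neg_sub (x p), ← neg_sub (y p), Real.arctan_neg, Real.arctan_neg]; ring)
    (fun j => x j - y j)
  have hnonneg : 0 ≤ ∑ p, (x p - y p) * ∑ q ∈ Finset.univ.erase p,
      (Real.arctan (x p - x q) - Real.arctan (y p - y q)) := by
    rw [hpair]
    refine Finset.sum_nonneg fun p _ => Finset.sum_nonneg fun q _ => ?_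
    split_ifs
    · rcases le_total (x p - x q) (y p - y q) with h | h
      · have := Real.arctan_mono h
        nlinarith
      · have := Real.arctan_mono h
        nlinarith
    · exact le_rfl
  have hsplit : ∑ j, (x j - y j) * (gradV n a b x j - gradV n a b y j)
      = ∑ j, ((x j - y j) * (gfun a (x j) - gfun a (y j))
          + (x j - y j) * (gfun b (x j) - gfun b (y j)))
        + ∑ p, (x p - y p) * ∑ q ∈ Finset.univ.erase p,
          (Real.arctan (x p - x q) - Real.arctan (y p - y q)) := by
    rw [← Finset.sum_add_distrib]
    refine Finset.sum_congr rfl fun j _ => ?_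
    rw [Finset.sum_sub_distrib, gradV, gradV]
    ring
  have hdiag : (slopeBound a M + slopeBound b M) * ∑ j, (x j - y j) ^ 2
      ≤ ∑ j, ((x j - y j) * (gfun a (x j) - gfun a (y j))
          + (x j - y j) * (gfun b (x j) - gfun b (y j))) := by
    rw [Finset.mul_sum]
    refine Finset.sum_le_sum fun j _ => ?_
    rw [add_mul]
    exact add_le_add (slopeBound_mul_sq_le ha (hx j) (hy j))
      (slopeBound_mul_sq_le hb (hx j) (hy j))
  linarith

lemma hasDerivAt_Gfun (a : ℂ) (s : ℝ) : HasDerivAt (Gfun a) (gfun a s) s :=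
  intervalIntegral.integral_hasDerivAt_right ((continuous_gfun a).intervalIntegrable _ _)
    (continuous_gfun a).aestronglyMeasurable.stronglyMeasurableAtFilter
    (continuous_gfun a).continuousAt

lemma hasDerivAt_Ffun (s : ℝ) : HasDerivAt Ffun (Real.arctan s) s :=
  intervalIntegral.integral_hasDerivAt_right (Real.continuous_arctan.intervalIntegrable _ _)
    Real.continuous_arctan.aestronglyMeasurable.stronglyMeasurableAtFilter
    Real.continuous_arctan.continuousAt

lemma hasDerivAt_V_line (n : ℕ) (a b : ℂ) (x u : Fin n → ℝ) :
    HasDerivAt (fun s : ℝ => V n a b fun j => x j + s * u j)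
      (∑ j, u j * gradV n a b x j) 0 := by
  have hline : ∀ j, HasDerivAt (fun s : ℝ => x j + s * u j) (u j) 0 := fun j => by
    simpa using ((hasDerivAt_id (0 : ℝ)).mul_const (u j)).const_add (x j)
  have hF : ∀ p q, HasDerivAt
      (fun s : ℝ => if p < q then Ffun ((x p + s * u p) - (x q + s * u q)) else 0)
      (if p < q then Real.arctan (x p - x q) * (u p - u q) else 0) 0 := by
    intro p q
    split_ifs
    · exact HasDerivAt.comp (h₂ := Ffun) (0 : ℝ) (by simpa using hasDerivAt_Ffun (x p - x q))
        ((hline p).fun_sub (hline q))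
    · exact hasDerivAt_const _ _
  have hG : ∀ (c : ℂ) j, HasDerivAt (fun s : ℝ => Gfun c (x j + s * u j))
      (gfun c (x j) * u j) 0 := by
    intro c j
    exact HasDerivAt.comp (h₂ := Gfun c) (0 : ℝ) (by simpa using hasDerivAt_Gfun c (x j)) (hline j)
  have hpair := HasDerivAt.fun_sum (u := Finset.univ) fun p _ =>
    HasDerivAt.fun_sum (u := Finset.univ) fun q _ => hF p q
  have hone := HasDerivAt.fun_sum (u := Finset.univ) fun j _ =>
    ((hG a j).add (hG b j)).add
      ((hline j).const_mul ((Real.pi / 2) * ((n : ℝ) + 1 - 2 * (((j : ℕ) : ℝ) + 1))))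
  refine (hpair.add hone).congr_deriv ?_
  rw [← sum_mul_sum_erase_of_antisymm (fun p q => Real.arctan (x p - x q))
    (fun p q => by rw [← neg_sub (x p), Real.arctan_neg]) u, ← Finset.sum_add_distrib]
  refine Finset.sum_congr rfl fun j _ => ?_
  rw [gradV]
  ring

lemma gradV_eq_zero_of_isMin {n : ℕ} {a b : ℂ} {x : Fin n → ℝ}
    (hmin : ∀ y : Fin n → ℝ, V n a b x ≤ V n a b y) (j : Fin n) : gradV n a b x j = 0 := by
  have hloc : IsLocalMin (fun s : ℝ => V n a b fun i => x i + s * (Pi.single j 1 : Fin n → ℝ) i)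
      0 := by
    refine Filter.Eventually.of_forall fun s => ?_
    simpa using hmin _
  have := hloc.hasDerivAt_eq_zero (hasDerivAt_V_line n a b x (Pi.single j 1))
  simpa [Pi.single_apply] using this

lemma gradV_neg_rev {n : ℕ} (a b : ℂ) (x : Fin n → ℝ) (j : Fin n) :
    gradV n a b (fun i => -x i.rev) j = -gradV n a b x j.rev := by
  have hcoef : (((j.rev : Fin n) : ℕ) : ℝ) = (n : ℝ) - 1 - ((j : ℕ) : ℝ) := by
    rw [Fin.val_rev, Nat.cast_sub (by omega)]
    push_cast
    ring
  have hsum : ∑ k ∈ Finset.univ.erase j, Real.arctan (-x j.rev - -x k.rev)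
      = -∑ k ∈ Finset.univ.erase j.rev, Real.arctan (x j.rev - x k) := by
    rw [Finset.sum_erase _ (by simp), Finset.sum_erase _ (by simp), ← Finset.sum_neg_distrib]
    refine Fintype.sum_equiv Fin.revPerm _ _ fun k => ?_
    rw [Fin.revPerm_apply, ← Real.arctan_neg]
    congr 1
    ring
  simp only [gradV, hcoef, gfun_neg, hsum]
  ring

lemma eq_of_gradV_eq_zero {n : ℕ} {a b : ℂ} (ha : 0 < a.re) (hb : 0 < b.re) {x y : Fin n → ℝ}
    (hx : ∀ j, gradV n a b x j = 0) (hy : ∀ j, gradV n a b y j = 0) : x = y := by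
  have hxM : ∀ j, |x j| ≤ ∑ i, (|x i| + |y i|) := fun j =>
    (le_add_of_nonneg_right (abs_nonneg _)).trans
      (Finset.single_le_sum (f := fun i => |x i| + |y i|) (fun i _ => by positivity)
        (Finset.mem_univ j))
  have hyM : ∀ j, |y j| ≤ ∑ i, (|x i| + |y i|) := fun j =>
    (le_add_of_nonneg_left (abs_nonneg _)).trans
      (Finset.single_le_sum (f := fun i => |x i| + |y i|) (fun i _ => by positivity)
        (Finset.mem_univ j))
  have h := slopeBound_mul_sum_sq_le ha hb hxM hyM
  simp only [hx, hy, sub_self, mul_zero, Finset.sum_const_zero] at h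
  have hc := add_pos (slopeBound_pos ha (∑ i, (|x i| + |y i|)))
    (slopeBound_pos hb (∑ i, (|x i| + |y i|)))
  have hs : ∑ j, (x j - y j) ^ 2 = 0 :=
    le_antisymm (nonpos_of_mul_nonpos_right h hc) (Finset.sum_nonneg fun _ _ => sq_nonneg _)
  funext j
  have := (Finset.sum_eq_zero_iff_of_nonneg fun _ _ => sq_nonneg _).1 hs j (Finset.mem_univ j)
  exact sub_eq_zero.1 (pow_eq_zero_iff two_ne_zero |>.1 this)

lemma le_mul_exp_of_hasDerivWithinAt_le {W W' : ℝ → ℝ} {T c : ℝ} (hT : 0 ≤ T)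
    (hW : ∀ t ∈ Set.Ici (0 : ℝ), HasDerivWithinAt W (W' t) (Set.Ici 0) t)
    (hle : ∀ t, T ≤ t → W' t ≤ -c * W t) {t : ℝ} (ht : T ≤ t) :
    W t ≤ W T * Real.exp (-c * (t - T)) := by
  have hexp : ∀ s, HasDerivAt (fun s => Real.exp (c * (s - T))) (Real.exp (c * (s - T)) * c) s :=
    fun s => by
      simpa using (((hasDerivAt_id s).sub_const T).const_mul c).exp
  have hprod : ∀ s, T ≤ s → HasDerivWithinAt (fun s => W s * Real.exp (c * (s - T)))
      (W' s * Real.exp (c * (s - T)) + W s * (Real.exp (c * (s - T)) * c)) (Set.Ici T) s :=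
    fun s hs => ((hW s (hT.trans hs)).mono (Set.Ici_subset_Ici.2 hT)).mul
      (hexp s).hasDerivWithinAt
  have hanti : AntitoneOn (fun s => W s * Real.exp (c * (s - T))) (Set.Ici T) := by
    refine antitoneOn_of_hasDerivWithinAt_nonpos (convex_Ici T)
      (fun s hs => (hprod s hs).continuousWithinAt)
      (fun s hs => (hprod s (interior_subset hs)).mono interior_subset) fun s hs => ?_
    have := mul_le_mul_of_nonneg_right (hle s (interior_subset hs))
      (Real.exp_pos (c * (s - T))).le
    linarith
  have h := hanti Set.self_mem_Ici (Set.mem_Ici.2 ht) ht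
  simp only [sub_self, mul_zero, Real.exp_zero, mul_one] at h
  rw [neg_mul, Real.exp_neg, ← div_eq_mul_inv]
  exact (le_div_iff₀ (Real.exp_pos _)).2 h

/-- exponential convergence of the continuous Hahn gradient flow
`dx_j/dt = −∂V/∂x_j`, i.e.
`dx_j/dt + (π/2)(n+1−2j) + g_a(x_j) + g_b(x_j) + Σ_{k≠j} arctan(x_j − x_k) = 0`,
to the unique global minimizer `x* = (x₁*, …, xₙ*)` of `V` (with `x₁* < ⋯ < xₙ*` and
`Rₙ = xₙ*`): for any `0 < κ < Re a/(Re²a + (Rₙ+|Im a|)²) + Re b/(Re²b + (Rₙ+|Im b|)²)`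
there is `K > 0` with `|x_j(t) − x_j*| ≤ K e^{−κt}` for all `j` and `t ≥ 0`. -/
theorem continuousHahn_gradient_flow_exponential_convergence
    (n : ℕ) (hn : 0 < n) (a b : ℂ) (ha : 0 < a.re) (hb : 0 < b.re) (hab : PairCond a b)
    (xs : Fin n → ℝ) (hmin : ∀ y : Fin n → ℝ, V n a b xs ≤ V n a b y)
    (hmono : StrictMono xs)
    (x : ℝ → Fin n → ℝ)
    (hode : ∀ t ∈ Set.Ici (0 : ℝ), ∀ j : Fin n,
      HasDerivWithinAt (fun s => x s j)
        (-((Real.pi / 2) * ((n : ℝ) + 1 - 2 * (((j : ℕ) : ℝ) + 1))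
            + gfun a (x t j) + gfun b (x t j)
            + ∑ k ∈ Finset.univ.erase j, Real.arctan (x t j - x t k)))
        (Set.Ici (0 : ℝ)) t)
    (κ : ℝ) (hκ0 : 0 < κ)
    (hκ : κ < a.re / (a.re ^ 2 + (xs ⟨n - 1, by omega⟩ + |a.im|) ^ 2)
             + b.re / (b.re ^ 2 + (xs ⟨n - 1, by omega⟩ + |b.im|) ^ 2)) :
    ∃ K > (0 : ℝ), ∀ j : Fin n, ∀ t ∈ Set.Ici (0 : ℝ),
      |x t j - xs j| ≤ K * Real.exp (-κ * t) := by
  have hcrit := gradV_eq_zero_of_isMin hmin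
  set R := xs ⟨n - 1, by omega⟩ with hR
  have hle : ∀ j, xs j ≤ R := fun j => hmono.monotone (Fin.mk_le_mk.2 (by omega) : j ≤ ⟨n - 1, _⟩)
  have hsymm : (fun j : Fin n => -xs j.rev) = xs :=
    eq_of_gradV_eq_zero ha hb (fun j => by rw [gradV_neg_rev, hcrit, neg_zero]) hcrit
  have habs : ∀ j, |xs j| ≤ R := fun j =>
    abs_le'.2 ⟨hle j, by
      have := congrFun hsymm j
      have := hle j.rev
      linarith⟩
  set W : ℝ → ℝ := fun t => ∑ j, (x t j - xs j) ^ 2 with hWdef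
  set W' : ℝ → ℝ := fun t => ∑ j, 2 * (x t j - xs j) * (-gradV n a b (x t) j) with hW'def
  have hW0 : ∀ t, 0 ≤ W t := fun t => Finset.sum_nonneg fun _ _ => sq_nonneg _
  have hderiv : ∀ t ∈ Set.Ici (0 : ℝ), HasDerivWithinAt W (W' t) (Set.Ici 0) t := by
    intro t ht
    refine HasDerivWithinAt.fun_sum fun j _ => ?_
    simpa [gradV] using ((hode t ht j).sub_const (xs j)).fun_pow 2
  have hdiss : ∀ M t, R ≤ M → (∀ j, |x t j| ≤ M) →
      W' t ≤ -(2 * (slopeBound a M + slopeBound b M)) * W t := by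
    intro M t hM hx
    have h := slopeBound_mul_sum_sq_le ha hb hx fun j => (habs j).trans hM
    have e : W' t = -2 * ∑ j, (x t j - xs j) * (gradV n a b (x t) j - gradV n a b xs j) := by
      rw [Finset.mul_sum]
      refine Finset.sum_congr rfl fun j _ => ?_
      rw [hcrit]
      ring
    rw [e]
    linarith
  have hcoord : ∀ t j, |x t j - xs j| ≤ √(W t) := fun t j =>
    Real.abs_le_sqrt (Finset.single_le_sum (f := fun j => (x t j - xs j) ^ 2)
      (fun _ _ => sq_nonneg _) (Finset.mem_univ j))
  have hbound : ∀ t j, |x t j| ≤ R + √(W t) := by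
    intro t j
    have h := abs_add_le (xs j) (x t j - xs j)
    rw [add_sub_cancel] at h
    linarith [habs j, hcoord t j]
  have hWle : ∀ t, 0 ≤ t → W t ≤ W 0 := by
    intro t ht
    have := le_mul_exp_of_hasDerivWithinAt_le (c := 0) le_rfl hderiv (fun s _ => by
      have h := hdiss (R + √(W s)) s (le_add_of_nonneg_right (Real.sqrt_nonneg _)) (hbound s)
      have hc := add_pos (slopeBound_pos ha (R + √(W s))) (slopeBound_pos hb (R + √(W s)))
      nlinarith [hW0 s]) ht
    simpa using this
  have hM : R ≤ R + √(W 0) := le_add_of_nonneg_right (Real.sqrt_nonneg _)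
  set c := 2 * (slopeBound a (R + √(W 0)) + slopeBound b (R + √(W 0))) with hc
  have hcpos : 0 < c := by
    have := slopeBound_pos ha (R + √(W 0))
    have := slopeBound_pos hb (R + √(W 0))
    positivity
  have hdecay : ∀ t, 0 ≤ t → W t ≤ W 0 * Real.exp (-c * (t - 0)) := fun t ht =>
    le_mul_exp_of_hasDerivWithinAt_le le_rfl hderiv (fun s hs => hdiss _ s hM fun j =>
      (hbound s j).trans (by gcongr; exact hWle s hs)) ht
  obtain ⟨ε, hεκ, hε⟩ : ∃ ε : ℝ, κ < slopeBound a (R + ε) + slopeBound b (R + ε) ∧ 0 < ε := by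
    have hcont : Continuous fun ε => slopeBound a (R + ε) + slopeBound b (R + ε) :=
      ((continuous_slopeBound ha).comp (continuous_const.add continuous_id)).add
        ((continuous_slopeBound hb).comp (continuous_const.add continuous_id))
    have hev : ∀ᶠ ε in nhds (0 : ℝ), κ < slopeBound a (R + ε) + slopeBound b (R + ε) :=
      hcont.continuousAt.eventually (lt_mem_nhds (by simpa [slopeBound] using hκ))
    exact ((hev.filter_mono nhdsWithin_le_nhds).and self_mem_nhdsWithin :
      ∀ᶠ ε in nhdsWithin (0 : ℝ) (Set.Ioi 0), _).exists
  obtain ⟨T, hT0, hT⟩ : ∃ T, 0 ≤ T ∧ ∀ t, T ≤ t → W t ≤ ε ^ 2 := by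
    have hlim : Filter.Tendsto (fun t => W 0 * Real.exp (-c * (t - 0))) Filter.atTop
        (nhds (W 0 * 0)) := by
      refine (Real.tendsto_exp_atBot.comp ?_).const_mul _
      simpa using Filter.tendsto_id.const_mul_atTop hcpos
    rw [mul_zero] at hlim
    obtain ⟨T, hT⟩ := Filter.eventually_atTop.1 (hlim.eventually (gt_mem_nhds (pow_pos hε 2)))
    exact ⟨max T 0, le_max_right _ _, fun t ht =>
      (hdecay t ((le_max_right _ _).trans ht)).trans (hT t ((le_max_left _ _).trans ht)).le⟩
  have hfast : ∀ t, 0 ≤ t → W t ≤ W 0 * Real.exp (-(2 * κ) * (t - T)) := by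
    intro t ht
    rcases le_total T t with h | h
    · refine (le_mul_exp_of_hasDerivWithinAt_le (c := 2 * κ) hT0 hderiv (fun s hs => ?_) h).trans
        (mul_le_mul_of_nonneg_right (hWle T hT0) (Real.exp_pos _).le)
      have h1 := hdiss (R + ε) s (by linarith) fun j =>
        (hbound s j).trans (by gcongr; exact Real.sqrt_le_iff.2 ⟨hε.le, hT s hs⟩)
      nlinarith [hW0 s]
    · refine (hWle t ht).trans (le_mul_of_one_le_right (hW0 0) (Real.one_le_exp ?_))
      nlinarith
  refine ⟨√(W 0) * Real.exp (κ * T) + 1, by positivity, fun j t ht => ?_⟩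
  have hsq : W 0 * Real.exp (-(2 * κ) * (t - T))
      = (√(W 0) * Real.exp (κ * T) * Real.exp (-κ * t)) ^ 2 := by
    rw [mul_assoc, mul_pow, Real.sq_sqrt (hW0 0), ← Real.exp_add, ← Real.exp_nat_mul]
    congr 2
    push_cast
    ring
  have h := (hcoord t j).trans (Real.sqrt_le_sqrt (hfast t ht))
  rw [hsq, Real.sqrt_sq (by positivity)] at h
  refine h.trans ?_
  gcongr
  linarith
end
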